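/- For every k ∈ ℕ and every model M ⊨ T_MSO(Fin), there exists n ∈ ℕ such that M ≈_k MSO(n). -/

import Mathlib

open FirstOrder FirstOrder.Language

namespace MSO

/-! ### The language `L_⊗` and its semantics -/

/-- The language `L_⊗`: a constant `⊥`, a unary relation `At`,
and two binary relations: `⊆` (encoded `true`) and `≤ᴱ` (encoded `false`). -/
def Lmso : Language where
  Functions := fun n => match n with | 0 => Unit | _ => Empty
  Relations := fun n => match n with | 1 => Unit | 2 => Bool | _ => Empty

/-- The constant symbol `⊥`. -/
def botC : Lmso.Constants := Unit.unit
/-- The unary relation symbol `At`. -/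
def atR : Lmso.Relations 1 := Unit.unit
/-- The binary relation symbol `⊆`. -/
def subR : Lmso.Relations 2 := true
/-- The binary relation symbol `≤ᴱ`. -/
def exleR : Lmso.Relations 2 := false

/-- The interpretation of `⊥` in an `L_⊗`-structure. -/
def botE (M : Type*) [Lmso.Structure M] : M := Structure.funMap botC ![]
/-- The interpretation of `At` in an `L_⊗`-structure. -/
def atE {M : Type*} [Lmso.Structure M] (a : M) : Prop := Structure.RelMap atR ![a]
/-- The interpretation of `⊆` in an `L_⊗`-structure. -/
def subE {M : Type*} [Lmso.Structure M] (a b : M) : Prop := Structure.RelMap subR ![a, b]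
/-- The interpretation of `≤ᴱ` in an `L_⊗`-structure. -/
def exleE {M : Type*} [Lmso.Structure M] (a b : M) : Prop := Structure.RelMap exleR ![a, b]

/-- The monadic second order version `M̃SO(α)` of a linear order `α`, as an `L_⊗`-structure:
the universe is the powerset of `α`, `⊆` is inclusion, `⊥` is `∅`, `At` holds of singletons,
and `A ≤ᴱ B` iff there are `a ∈ A` and `b ∈ B` with `a < b`. -/
instance msoStructure (α : Type*) [LinearOrder α] : Lmso.Structure (Set α) where
  funMap := fun {n} f _ => match n, f with
    | 0, _ => (∅ : Set α)
  RelMap := fun {n} r v => match n, r with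
    | 1, _ => ∃ a : α, v 0 = {a}
    | 2, true => v 0 ⊆ v 1
    | 2, false => ∃ a ∈ v 0, ∃ b ∈ v 1, a < b

/-- `MSO(n)`, the monadic second order version of the `n`-element linear order. -/
abbrev MSOn (n : ℕ) : Type := Set (Fin n)

/-- The operation `⊗` on `L_⊗`-structures: the universe is the product, `⊆` is componentwise,
`⊥` is the pair of bottoms, `At` holds of the atoms (minimal non-bottom elements) of the
resulting order, and `(A,B) ≤ᴱ (C,D)` iff (`A ≠ ⊥` and `D ≠ ⊥`), or `A ≤ᴱ C`, or `B ≤ᴱ D`. -/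
instance tensorStructure (M N : Type*) [Lmso.Structure M] [Lmso.Structure N] :
    Lmso.Structure (M × N) where
  funMap := fun {n} f _ => match n, f with
    | 0, _ => (botE M, botE N)
  RelMap := fun {n} r v => match n, r with
    | 1, _ => v 0 ≠ (botE M, botE N) ∧
        ∀ q : M × N, subE q.1 (v 0).1 → subE q.2 (v 0).2 →
          q = (botE M, botE N) ∨ q = v 0
    | 2, true => subE (v 0).1 (v 1).1 ∧ subE (v 0).2 (v 1).2
    | 2, false => ((v 0).1 ≠ botE M ∧ (v 1).2 ≠ botE N) ∨
        exleE (v 0).1 (v 1).1 ∨ exleE (v 0).2 (v 1).2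

/-! ### Formulas -/

/-- Bounded `L_⊗`-formulas with no free (outer) variables. -/
abbrev BF (n : ℕ) := Lmso.BoundedFormula Empty n

/-- The `i`-th de Bruijn variable as a term. -/
def tv {n : ℕ} (i : Fin n) : Lmso.Term (Empty ⊕ Fin n) := Term.var (Sum.inr i)
/-- The constant `⊥` as a term. -/
def tb {n : ℕ} : Lmso.Term (Empty ⊕ Fin n) := Constants.term botC

def sub' {n : ℕ} (i j : Fin n) : BF n := subR.boundedFormula₂ (tv i) (tv j)
def exle' {n : ℕ} (i j : Fin n) : BF n := exleR.boundedFormula₂ (tv i) (tv j)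
def at' {n : ℕ} (i : Fin n) : BF n := atR.boundedFormula₁ (tv i)
def eq' {n : ℕ} (i j : Fin n) : BF n := Term.bdEqual (tv i) (tv j)
def isBot' {n : ℕ} (i : Fin n) : BF n := Term.bdEqual (tv i) tb
def botSub' {n : ℕ} (i : Fin n) : BF n := subR.boundedFormula₂ tb (tv i)

/-- Finite conjunction. -/
def bigAnd {n : ℕ} (l : List (BF n)) : BF n := l.foldr (· ⊓ ·) ⊤
/-- Finite disjunction. -/
def bigOr {n : ℕ} (l : List (BF n)) : BF n := l.foldr (· ⊔ ·) ⊥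

/-- `k` is the meet of `i` and `j` (with respect to `⊆`). -/
def isMeet {n : ℕ} (k i j : Fin n) : BF n :=
  sub' k i ⊓ sub' k j ⊓
    ∀' ((sub' (Fin.last n) i.castSucc ⊓ sub' (Fin.last n) j.castSucc) ⟹
      sub' (Fin.last n) k.castSucc)

/-- `k` is the join of `i` and `j` (with respect to `⊆`). -/
def isJoin {n : ℕ} (k i j : Fin n) : BF n :=
  sub' i k ⊓ sub' j k ⊓
    ∀' ((sub' i.castSucc (Fin.last n) ⊓ sub' j.castSucc (Fin.last n)) ⟹
      sub' k.castSucc (Fin.last n))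

/-- The meet of `i` and `j` is `⊥`. -/
def meetIsBot {n : ℕ} (i j : Fin n) : BF n :=
  ∀' ((sub' (Fin.last n) i.castSucc ⊓ sub' (Fin.last n) j.castSucc) ⟹ isBot' (Fin.last n))

/-- The join of `i` and `j` is the top element. -/
def joinIsTop {n : ℕ} (i j : Fin n) : BF n :=
  ∀' ((sub' i.castSucc (Fin.last n) ⊓ sub' j.castSucc (Fin.last n)) ⟹
    ∀' (sub' (Fin.last (n + 1)) ((Fin.last n).castSucc)))

/-- `j` is a (Boolean) complement of `i`. -/
def isComplOf {n : ℕ} (j i : Fin n) : BF n := meetIsBot i j ⊓ joinIsTop i j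

/-- `i` is an atom: non-bottom, and minimal among non-bottom elements. -/
def isAtomDef {n : ℕ} (i : Fin n) : BF n :=
  ∼(isBot' i) ⊓
    ∀' (sub' (Fin.last n) i.castSucc ⟹ (isBot' (Fin.last n) ⊔ eq' (Fin.last n) i.castSucc))

/-! ### The base theory `T_base` -/

def axRefl : Lmso.Sentence := ∀' sub' 0 0
def axAntisymm : Lmso.Sentence := ∀' ∀' ((sub' 0 1 ⊓ sub' 1 0) ⟹ eq' 0 1)
def axTrans : Lmso.Sentence := ∀' ∀' ∀' ((sub' 0 1 ⊓ sub' 1 2) ⟹ sub' 0 2)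
def axBotLe : Lmso.Sentence := ∀' botSub' 0
def axTop : Lmso.Sentence := ∃' ∀' (sub' 1 0)
def axMeet : Lmso.Sentence := ∀' ∀' ∃' (isMeet 2 0 1)
def axJoin : Lmso.Sentence := ∀' ∀' ∃' (isJoin 2 0 1)
def axCompl : Lmso.Sentence := ∀' ∃' (isComplOf 1 0)
def axDistrib : Lmso.Sentence :=
  ∀' ∀' ∀' ∀' ∀' ∀' ∀' ∀'
    ((isMeet 3 0 1 ⊓ isMeet 4 0 2 ⊓ isJoin 5 1 2 ⊓ isMeet 6 0 5 ⊓ isJoin 7 3 4) ⟹ sub' 6 7)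
def axAt : Lmso.Sentence := ∀' (at' 0 ⇔ isAtomDef 0)
def axAtomic : Lmso.Sentence := ∀' (∼(isBot' 0) ⟹ ∃' (at' 1 ⊓ sub' 1 0))
def axIrrefl : Lmso.Sentence := ∀' (at' 0 ⟹ ∼(exle' 0 0))
def axTransAt : Lmso.Sentence :=
  ∀' ∀' ∀' ((at' 0 ⊓ at' 1 ⊓ at' 2 ⊓ exle' 0 1 ⊓ exle' 1 2) ⟹ exle' 0 2)
def axTrich : Lmso.Sentence :=
  ∀' ∀' ((at' 0 ⊓ at' 1) ⟹ (exle' 0 1 ⊔ eq' 0 1 ⊔ exle' 1 0))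
def axExleDef : Lmso.Sentence :=
  ∀' ∀' (exle' 0 1 ⇔ ∃' ∃' (at' 2 ⊓ at' 3 ⊓ sub' 2 0 ⊓ sub' 3 1 ⊓ exle' 2 3))

/-- The comprehension axiom for a formula `η(x; Y₁,…,Yₙ)` (with `x` the last variable):
`∀ Ȳ ∃ X ∀ x (At x → (x ⊆ X ↔ η(x; Ȳ)))`. -/
def compAx {n : ℕ} (η : BF (n + 1)) : Lmso.Sentence :=
  BoundedFormula.alls (∃' ∀' (at' (Fin.last (n + 1)) ⟹
    (sub' (Fin.last (n + 1)) ((Fin.last n).castSucc) ⇔ η.liftAt 1 n)))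

/-- The base theory `T_base`: an atomic Boolean algebra under `⊆` with bottom `⊥`, `At`
holding exactly of the atoms, `≤ᴱ` linearly ordering the atoms and determined by its
restriction to the atoms, together with the comprehension scheme. -/
def Tbase : Lmso.Theory :=
  {axRefl, axAntisymm, axTrans, axBotLe, axTop, axMeet, axJoin, axCompl, axDistrib,
    axAt, axAtomic, axIrrefl, axTransAt, axTrich, axExleDef} ∪
  ⋃ n : ℕ, Set.range (compAx (n := n))

/-! ### The theory `T_MSO(Fin)` -/

/-- `i` is the `≤ᴱ`-least atom. -/
def isLeastAtom {n : ℕ} (i : Fin n) : BF n :=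
  at' i ⊓ ∀' (at' (Fin.last n) ⟹ ∼(exle' (Fin.last n) i.castSucc))

/-- `i` is the `≤ᴱ`-greatest atom. -/
def isGreatestAtom {n : ℕ} (i : Fin n) : BF n :=
  at' i ⊓ ∀' (at' (Fin.last n) ⟹ ∼(exle' i.castSucc (Fin.last n)))

/-- `j` is the immediate `≤ᴱ`-successor of the atom `i`. -/
def isSuccOf {n : ℕ} (j i : Fin n) : BF n :=
  at' i ⊓ at' j ⊓ exle' i j ⊓
    ∀' ((at' (Fin.last n) ⊓ exle' i.castSucc (Fin.last n)) ⟹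
      (eq' (Fin.last n) j.castSucc ⊔ exle' j.castSucc (Fin.last n)))

def axLeastAtom : Lmso.Sentence := (∃' at' 0) ⟹ ∃' isLeastAtom 0
def axGreatestAtom : Lmso.Sentence := (∃' at' 0) ⟹ ∃' isGreatestAtom 0
def axSucc : Lmso.Sentence :=
  ∀' ((at' 0 ⊓ ∃' (at' 1 ⊓ exle' 0 1)) ⟹ ∃' isSuccOf 1 0)
def axPred : Lmso.Sentence :=
  ∀' ((at' 0 ⊓ ∃' (at' 1 ⊓ exle' 1 0)) ⟹ ∃' isSuccOf 0 1)
def axLeastIn : Lmso.Sentence :=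
  ∀' (∼(isBot' 0) ⟹ ∃' (at' 1 ⊓ sub' 1 0 ⊓ ∀' ((at' 2 ⊓ sub' 2 0) ⟹ ∼(exle' 2 1))))

/-- The theory `T_MSO(Fin)`: `T_base` together with axioms saying that the ordering of the
atoms is discrete with endpoints, and every non-bottom element contains a least atom. -/
def TMSOFin : Lmso.Theory :=
  Tbase ∪ {axLeastAtom, axGreatestAtom, axSucc, axPred, axLeastIn}

/-! ### Quantifier rank, unnested formulas, and `≈ₖ` -/

/-- Quantifier rank of a bounded formula. -/
def qr : ∀ {n : ℕ}, BF n → ℕ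
  | _, BoundedFormula.falsum => 0
  | _, BoundedFormula.equal _ _ => 0
  | _, BoundedFormula.rel _ _ => 0
  | _, BoundedFormula.imp f g => max (qr f) (qr g)
  | _, BoundedFormula.all f => qr f + 1

/-- A formula is unnested if every atomic subformula is of one of the forms
`x = y`, `c = y`, or `R x̄` with the `xᵢ`, `y` variables (Hodges). -/
def IsUnnested : ∀ {n : ℕ}, BF n → Prop
  | _, BoundedFormula.falsum => True
  | _, BoundedFormula.equal s t =>
      (∃ i j, s = Term.var i ∧ t = Term.var j) ∨
      (∃ (c : Lmso.Constants) (j : _), s = Constants.term c ∧ t = Term.var j)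
  | _, BoundedFormula.rel _ ts => ∀ i, ∃ j, ts i = Term.var j
  | _, BoundedFormula.imp f g => IsUnnested f ∧ IsUnnested g
  | _, BoundedFormula.all f => IsUnnested f

/-- `M ≈ₖ N` : `M` and `N` satisfy the same unnested `L_⊗`-sentences of quantifier
rank at most `k`. -/
def EquivK (k : ℕ) (M N : Type*) [Lmso.Structure M] [Lmso.Structure N] : Prop :=
  ∀ φ : Lmso.Sentence, IsUnnested φ → qr φ ≤ k → (M ⊨ φ ↔ N ⊨ φ)

/-! ### The sentences `ρ_{d,h}`, `ψ_{>n}`, `ψ_{=n}` -/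

/-- The index (in `Fin d`) of `A_h` among `A₁, …, A_d`, identifying `h = 0` with `h = d`. -/
def aIdx (d h : ℕ) (hd : 0 < d) : Fin d := ⟨(h + d - 1) % d, Nat.mod_lt _ hd⟩

/-- The cyclic successor on the indices `{1, …, d}`. -/
def cyc {d : ℕ} (j : Fin d) : Fin d := ⟨((j : ℕ) + 1) % d, Nat.mod_lt _ j.pos⟩

/-- The sentence `ρ_{d,h}`: there is a partition of the atoms into `d` non-bottom elements
`A₁, …, A_d` such that the least atom is in `A₁`, the immediate successor of an atom lying in
`A_j` lies in `A_{j+1}` (cyclically), and the greatest atom is in `A_h`. -/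
def rho (d h : ℕ) : Lmso.Sentence :=
  if hd : 0 < d then
    BoundedFormula.exs (n := d) (
      -- each `A_i` is non-bottom
      bigAnd ((List.finRange d).map fun i => ∼(isBot' i)) ⊓
      -- every atom lies in some `A_i`
      (∀' (at' (Fin.last d) ⟹
        bigOr ((List.finRange d).map fun i => sub' (Fin.last d) i.castSucc))) ⊓
      -- the `A_i` are pairwise disjoint on atoms
      bigAnd ((List.finRange d).flatMap fun i => (List.finRange d).filterMap fun j =>
        if i.val < j.val then
          some (∀' (at' (Fin.last d) ⟹
            ∼(sub' (Fin.last d) i.castSucc ⊓ sub' (Fin.last d) j.castSucc)))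
        else none) ⊓
      -- the least atom lies in `A₁`
      (∀' (isLeastAtom (Fin.last d) ⟹ sub' (Fin.last d) ((aIdx d 1 hd).castSucc))) ⊓
      -- immediate successors move cyclically through the `A_j`
      bigAnd ((List.finRange d).map fun j =>
        ∀' ∀' ((sub' ((Fin.last d).castSucc) (j.castSucc.castSucc) ⊓
            isSuccOf (Fin.last (d + 1)) ((Fin.last d).castSucc)) ⟹
          sub' (Fin.last (d + 1)) ((cyc j).castSucc.castSucc))) ⊓
      -- the greatest atom lies in `A_h`
      (∀' (isGreatestAtom (Fin.last d) ⟹ sub' (Fin.last d) ((aIdx d h hd).castSucc))))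
  else ⊥

/-- The list of formulas `xᵢ ≠ xⱼ` for `i < j < n`. -/
def distinctPairs (n : ℕ) : List (BF n) :=
  (List.finRange n).flatMap fun i => (List.finRange n).filterMap fun j =>
    if i.val < j.val then some (∼(eq' i j)) else none

/-- `ψ_{>n}` : there exist at least `n + 1` distinct atoms. -/
def psiGt (n : ℕ) : Lmso.Sentence :=
  BoundedFormula.exs (n := n + 1)
    (bigAnd ((List.finRange (n + 1)).map fun i => at' i) ⊓ bigAnd (distinctPairs (n + 1)))

/-- `ψ_{=n}` : there exist exactly `n` distinct atoms. -/
def psiEq (n : ℕ) : Lmso.Sentence :=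
  BoundedFormula.exs (n := n)
    (bigAnd ((List.finRange n).map fun i => at' i) ⊓ bigAnd (distinctPairs n) ⊓
      ∀' (at' (Fin.last n) ⟹ bigOr ((List.finRange n).map fun i => eq' (Fin.last n) i.castSucc)))

/-! ### Residue functions and the theories `T_r̃` -/

/-- A residue function `ℙ × ℕ_{>0} → ℕ` (conditions imposed only at primes `p` and `j ≥ 1`):
`r(p,j) < p^j` and `r(p,j+1) ≡ r(p,j) [MOD p^j]`. -/
def IsResidueFunction (r : ℕ → ℕ → ℕ) : Prop :=
  ∀ p j : ℕ, p.Prime → 1 ≤ j → r p j < p ^ j ∧ r p (j + 1) ≡ r p j [MOD p ^ j]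

/-- A function `ℕ_{>1} → ℕ` is a residue function if it arises from a residue function
`ℙ × ℕ_{>0} → ℕ` as in the paper (conditions imposed only for `d > 1`). -/
def IsResidueFunctionTilde (rt : ℕ → ℕ) : Prop :=
  ∃ r : ℕ → ℕ → ℕ, IsResidueFunction r ∧
    ∀ d : ℕ, 1 < d → rt d < d ∧
      ∀ p j : ℕ, p.Prime → 1 ≤ j → p ^ j ∣ d → rt d ≡ r p j [MOD p ^ j]

/-- The theory `T_r̃ = T_MSO(Fin) ∪ {ψ_{>n} : n ∈ ℕ} ∪ {ρ_{d,r̃(d)} : d > 1}`. -/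
def Trt (rt : ℕ → ℕ) : Lmso.Theory :=
  TMSOFin ∪ Set.range psiGt ∪ {σ : Lmso.Sentence | ∃ d : ℕ, 1 < d ∧ σ = rho d (rt d)}

/-! ### Relativization and the sum of sentences -/

/-- Relativization of a formula to the elements `⊆ v`:
each quantifier `∀ Z (…)` becomes `∀ Z (Z ⊆ v → …)`. -/
def relv : ∀ {n : ℕ}, BF n → Fin n → BF n
  | _, BoundedFormula.falsum, _ => BoundedFormula.falsum
  | _, BoundedFormula.equal s t, _ => BoundedFormula.equal s t
  | _, BoundedFormula.rel r ts, _ => BoundedFormula.rel r ts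
  | _, BoundedFormula.imp f g, v => (relv f v).imp (relv g v)
  | n, BoundedFormula.all f, v =>
      BoundedFormula.all (sub' (Fin.last n) v.castSucc ⟹ relv f v.castSucc)

/-- `i` is downward closed with respect to the `≤ᴱ`-ordering of the atoms. -/
def dwcl' {n : ℕ} (i : Fin n) : BF n :=
  ∀' ∀' ((at' ((Fin.last n).castSucc) ⊓ at' (Fin.last (n + 1)) ⊓
      sub' ((Fin.last n).castSucc) (i.castSucc.castSucc) ⊓
      exle' (Fin.last (n + 1)) ((Fin.last n).castSucc)) ⟹
    sub' (Fin.last (n + 1)) (i.castSucc.castSucc))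

/-- The sentence `φ + ψ` : `∃ X (X downward closed ∧ φ^X ∧ ψ^(Xᶜ))`
(with the complement `Xᶜ` introduced by an existential quantifier). -/
def plusSent (φ ψ : Lmso.Sentence) : Lmso.Sentence :=
  ∃' ∃' (dwcl' (0 : Fin 2) ⊓ isComplOf (1 : Fin 2) (0 : Fin 2) ⊓
    relv (φ.liftAt 2 0) (0 : Fin 2) ⊓ relv (ψ.liftAt 2 0) (1 : Fin 2))

/-! ### `FSpec` and ultimate periodicity -/

/-- `FSpec φ` : the set of `n ∈ ℕ` such that `MSO(n) ⊨ φ`. -/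
def FSpec (φ : Lmso.Sentence) : Set ℕ := {n : ℕ | MSOn n ⊨ φ}

/-- A set of naturals is ultimately periodic. -/
def UltPeriodic (S : Set ℕ) : Prop :=
  ∃ N d : ℕ, 0 < d ∧ ∀ n : ℕ, N < n → (n ∈ S ↔ n + d ∈ S)

/-! ### The language `L_MO = {⊆, <}` -/

/-- The language `L_MO` with two binary relations: `⊆` (encoded `true`) and `<`
(encoded `false`). -/
def Lmo : Language where
  Functions := fun _ => Empty
  Relations := fun n => match n with | 2 => Bool | _ => Empty

/-- The monadic second order version `MSO(α)` of a linear order `α` as an `L_MO`-structure: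
`⊆` is inclusion and `<` is the ordering of `α` on singletons. -/
instance moStructure (α : Type*) [LinearOrder α] : Lmo.Structure (Set α) where
  funMap := fun f _ => f.elim
  RelMap := fun {n} r v => match n, r with
    | 2, true => v 0 ⊆ v 1
    | 2, false => ∃ a b : α, v 0 = {a} ∧ v 1 = {b} ∧ a < b

/-! ### Types of tuples of sets -/

/-- The quantifier-free information carried by a pair of sets over a binary relation. -/
def pairType {α : Type*} (r : α → α → Prop) (S T : Set α) : Prop × Prop × Prop × Prop :=
  (S = ∅, ∃ a, S = {a}, S ⊆ T, ∃ a ∈ S, ∃ b ∈ T, r a b)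

/-- The possible rank `k` types of `m`-tuples. -/
def RankType : ℕ → ℕ → Type
  | 0, m => Fin m → Fin m → Prop × Prop × Prop × Prop
  | k + 1, m => Set (RankType k (m + 1))

/-- The rank `k` type of a tuple of sets, where the moves of the back-and-forth game are
restricted to the family `𝓕`. -/
def rankType {α : Type*} (r : α → α → Prop) (𝓕 : Set (Set α)) :
    ∀ k m : ℕ, (Fin m → Set α) → RankType k m
  | 0, _, s => fun i j => pairType r (s i) (s j)
  | k + 1, m, s => {t | ∃ X ∈ 𝓕, rankType r 𝓕 k (m + 1) (Fin.snoc s X) = t}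

instance finite_rankType : ∀ k m : ℕ, Finite (RankType k m)
  | 0, m => inferInstanceAs (Finite (Fin m → Fin m → Prop × Prop × Prop × Prop))
  | k + 1, m =>
    have := finite_rankType k (m + 1)
    inferInstanceAs (Finite (Set (RankType k (m + 1))))

section RankTypes

variable {α β γ δ : Type*} {r : α → α → Prop} {r' : β → β → Prop}

theorem exists_rankType_snoc_eq {𝓕 : Set (Set α)} {𝓖 : Set (Set β)} {k m : ℕ}
    {s : Fin m → Set α} {t : Fin m → Set β}
    (h : rankType r 𝓕 (k + 1) m s = rankType r' 𝓖 (k + 1) m t) {X : Set α} (hX : X ∈ 𝓕) :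
    ∃ Y ∈ 𝓖, rankType r 𝓕 k (m + 1) (Fin.snoc s X) = rankType r' 𝓖 k (m + 1) (Fin.snoc t Y) := by
  obtain ⟨Y, hY, e⟩ := ((Set.ext_iff (α := RankType k (m + 1))).1 h _).1 ⟨X, hX, rfl⟩
  exact ⟨Y, hY, e.symm⟩

theorem rankType_succ_eq {𝓕 : Set (Set α)} {𝓖 : Set (Set β)} {k m : ℕ}
    {s : Fin m → Set α} {t : Fin m → Set β}
    (h₁ : ∀ X ∈ 𝓕, ∃ Y ∈ 𝓖,
      rankType r 𝓕 k (m + 1) (Fin.snoc s X) = rankType r' 𝓖 k (m + 1) (Fin.snoc t Y))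
    (h₂ : ∀ Y ∈ 𝓖, ∃ X ∈ 𝓕,
      rankType r 𝓕 k (m + 1) (Fin.snoc s X) = rankType r' 𝓖 k (m + 1) (Fin.snoc t Y)) :
    rankType r 𝓕 (k + 1) m s = rankType r' 𝓖 (k + 1) m t := by
  refine Set.Subset.antisymm ?_ ?_
  · rintro _ ⟨X, hX, rfl⟩
    obtain ⟨Y, hY, e⟩ := h₁ X hX
    exact ⟨Y, hY, e.symm⟩
  · rintro _ ⟨Y, hY, rfl⟩
    obtain ⟨X, hX, e⟩ := h₂ Y hY
    exact ⟨X, hX, e⟩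

theorem pairType_eq_of_rankType_eq {𝓕 : Set (Set α)} {𝓖 : Set (Set β)} (h𝓕 : 𝓕.Nonempty) :
    ∀ {k m : ℕ} {s : Fin m → Set α} {t : Fin m → Set β},
      rankType r 𝓕 k m s = rankType r' 𝓖 k m t →
        ∀ i j, pairType r (s i) (s j) = pairType r' (t i) (t j)
  | 0, _, _, _, h, i, j => congrFun (congrFun h i) j
  | k + 1, m, s, t, h, i, j => by
    obtain ⟨X, hX⟩ := h𝓕
    obtain ⟨Y, -, e⟩ := exists_rankType_snoc_eq h hX
    simpa using pairType_eq_of_rankType_eq ⟨X, hX⟩ e i.castSucc j.castSucc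

theorem rankType_singleton_empty (r : α → α → Prop) (r' : β → β → Prop) :
    ∀ k m : ℕ, rankType r {∅} k m (fun _ => ∅) = rankType r' {∅} k m (fun _ => ∅)
  | 0, m => by
    funext i j
    have h₁ (a : α) : (∅ : Set α) ≠ {a} := (Set.singleton_ne_empty a).symm
    have h₂ (b : β) : (∅ : Set β) ≠ {b} := (Set.singleton_ne_empty b).symm
    simp [rankType, pairType, h₁, h₂]
  | k + 1, m => by
    have ih := rankType_singleton_empty r r' k (m + 1)
    have h₁ : (Fin.snoc (fun _ : Fin m => (∅ : Set α)) ∅ : Fin (m + 1) → Set α) = fun _ => ∅ := by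
      funext i
      refine Fin.lastCases ?_ (fun i => ?_) i <;> simp
    have h₂ : (Fin.snoc (fun _ : Fin m => (∅ : Set β)) ∅ : Fin (m + 1) → Set β) = fun _ => ∅ := by
      funext i
      refine Fin.lastCases ?_ (fun i => ?_) i <;> simp
    refine rankType_succ_eq ?_ ?_
    · rintro _ rfl
      exact ⟨∅, rfl, by rw [h₁, h₂, ih]⟩
    · rintro _ rfl
      exact ⟨∅, rfl, by rw [h₁, h₂, ih]⟩

/-- Push a set forward along `f` and add the point `p` if `ε` holds. -/
def addPoint (f : α → β) (p : β) (S : Set α) (ε : Prop) : Set β :=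
  f '' S ∪ {y | y = p ∧ ε}

/-- The quantifier-free type of two sets to which a largest point has been added according
to `ε` and `δ`, computed from the quantifier-free type of the original sets. -/
def pairTypeAdd (t : Prop × Prop × Prop × Prop) (ε δ : Prop) : Prop × Prop × Prop × Prop :=
  (t.1 ∧ ¬ε, (t.2.1 ∧ ¬ε) ∨ (t.1 ∧ ε), t.2.2.1 ∧ (ε → δ), t.2.2.2 ∨ (¬t.1 ∧ δ))

/-- The family `𝓖` over `r'` arises from the family `𝓕` over `r` by adding a largest point `p`. -/
structure IsExtension (r : α → α → Prop) (𝓕 : Set (Set α)) (r' : β → β → Prop)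
    (𝓖 : Set (Set β)) (f : α → β) (p : β) : Prop where
  inj : Function.Injective f
  rel_iff : ∀ a b, r' (f a) (f b) ↔ r a b
  irrefl : ¬r' p p
  lt_top : ∀ S ∈ 𝓕, ∀ a ∈ S, r' (f a) p
  not_top_lt : ∀ S ∈ 𝓕, ∀ a ∈ S, ¬r' p (f a)
  add_mem : ∀ S ∈ 𝓕, ∀ ε : Prop, addPoint f p S ε ∈ 𝓖
  exists_eq : ∀ Y ∈ 𝓖, ∃ S ∈ 𝓕, ∃ ε : Prop, addPoint f p S ε = Y

namespace IsExtension

variable {𝓕 : Set (Set α)} {𝓖 : Set (Set β)} {f : α → β} {p : β}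

theorem not_mem_image (h : IsExtension r 𝓕 r' 𝓖 f p) {S : Set α} (hS : S ∈ 𝓕) : p ∉ f '' S := by
  rintro ⟨a, ha, e⟩
  exact h.irrefl (by simpa [e] using h.lt_top S hS a ha)

theorem pairType_addPoint (h : IsExtension r 𝓕 r' 𝓖 f p) {S T : Set α} (hS : S ∈ 𝓕)
    (hT : T ∈ 𝓕) (ε δ : Prop) :
    pairType r' (addPoint f p S ε) (addPoint f p T δ) = pairTypeAdd (pairType r S T) ε δ := by
  have hpS := h.not_mem_image hS
  have hpT := h.not_mem_image hT
  have hsub : addPoint f p S ε ⊆ addPoint f p T δ ↔ S ⊆ T ∧ (ε → δ) := by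
    constructor
    · intro hst
      refine ⟨fun a ha => ?_, fun hε => ?_⟩
      · rcases hst (Or.inl ⟨a, ha, rfl⟩) with ⟨b, hb, e⟩ | ⟨e, -⟩
        · exact h.inj e ▸ hb
        · exact absurd ⟨a, ha, e⟩ hpS
      · rcases hst (Or.inr ⟨rfl, hε⟩) with hp | ⟨-, hδ⟩
        · exact absurd hp hpT
        · exact hδ
    · rintro ⟨hst, hεδ⟩ y (hy | ⟨rfl, hε⟩)
      · exact Or.inl (Set.image_mono hst hy)
      · exact Or.inr ⟨rfl, hεδ hε⟩
  have hempty : addPoint f p S ε = ∅ ↔ S = ∅ ∧ ¬ε := by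
    simp [addPoint, Set.eq_empty_iff_forall_notMem]
    grind
  have hsing : (∃ y, addPoint f p S ε = {y}) ↔ ((∃ a, S = {a}) ∧ ¬ε) ∨ (S = ∅ ∧ ε) := by
    constructor
    · rintro ⟨y, hy⟩
      by_cases hε : ε
      · have hp : p ∈ addPoint f p S ε := Or.inr ⟨rfl, hε⟩
        rw [hy] at hp
        refine Or.inr ⟨Set.eq_empty_iff_forall_notMem.2 fun a ha => ?_, hε⟩
        have hfa : f a ∈ addPoint f p S ε := Or.inl ⟨a, ha, rfl⟩
        rw [hy] at hfa
        exact hpS ⟨a, ha, hfa.trans hp.symm⟩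
      · simp only [addPoint, hε, and_false, Set.ofPred_false, Set.union_empty] at hy
        obtain ⟨a, ha, rfl⟩ : y ∈ f '' S := hy ▸ rfl
        refine Or.inl ⟨⟨a, Set.eq_singleton_iff_unique_mem.2 ⟨ha, fun b hb => h.inj ?_⟩⟩, hε⟩
        have hfb : f b ∈ f '' S := ⟨b, hb, rfl⟩
        rwa [hy] at hfb
    · rintro (⟨⟨a, rfl⟩, hε⟩ | ⟨rfl, hε⟩)
      · exact ⟨f a, by simp [addPoint, hε]⟩
      · exact ⟨p, by simp [addPoint, hε]⟩
  have hrel : (∃ a ∈ addPoint f p S ε, ∃ b ∈ addPoint f p T δ, r' a b) ↔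
      (∃ a ∈ S, ∃ b ∈ T, r a b) ∨ (¬S = ∅ ∧ δ) := by
    constructor
    · rintro ⟨_, ⟨a, ha, rfl⟩ | ⟨rfl, -⟩, _, ⟨b, hb, rfl⟩ | ⟨rfl, hδ⟩, hr⟩
      · exact Or.inl ⟨a, ha, b, hb, (h.rel_iff a b).1 hr⟩
      · exact Or.inr ⟨Set.nonempty_iff_ne_empty.1 ⟨a, ha⟩, hδ⟩
      · exact absurd hr (h.not_top_lt T hT b hb)
      · exact absurd hr h.irrefl
    · rintro (⟨a, ha, b, hb, hr⟩ | ⟨hne, hδ⟩)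
      · exact ⟨f a, Or.inl ⟨a, ha, rfl⟩, f b, Or.inl ⟨b, hb, rfl⟩, (h.rel_iff a b).2 hr⟩
      · obtain ⟨a, ha⟩ := Set.nonempty_iff_ne_empty.2 hne
        exact ⟨f a, Or.inl ⟨a, ha, rfl⟩, p, Or.inr ⟨rfl, hδ⟩, h.lt_top S hS a ha⟩
  simp only [pairType, pairTypeAdd, hsub, hempty, hsing, hrel]

end IsExtension

/-- Adding a largest point preserves equality of types. -/
theorem rankType_addPoint_eq {r₁ : γ → γ → Prop} {r₁' : δ → δ → Prop}
    {𝓕 : Set (Set α)} {𝓖 : Set (Set β)} {f : α → β} {p : β}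
    {𝓕₁ : Set (Set γ)} {𝓖₁ : Set (Set δ)} {f₁ : γ → δ} {p₁ : δ}
    (h : IsExtension r 𝓕 r' 𝓖 f p) (h₁ : IsExtension r₁ 𝓕₁ r₁' 𝓖₁ f₁ p₁) :
    ∀ {k m : ℕ} {s : Fin m → Set α} {t : Fin m → Set γ} (ε : Fin m → Prop),
      (∀ i, s i ∈ 𝓕) → (∀ i, t i ∈ 𝓕₁) → rankType r 𝓕 k m s = rankType r₁ 𝓕₁ k m t →
        rankType r' 𝓖 k m (fun i => addPoint f p (s i) (ε i)) =
          rankType r₁' 𝓖₁ k m (fun i => addPoint f₁ p₁ (t i) (ε i))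
  | 0, m, s, t, ε, hs, ht, e => by
    funext i j
    have hij : pairType r (s i) (s j) = pairType r₁ (t i) (t j) := congrFun (congrFun e i) j
    change pairType _ _ _ = pairType _ _ _
    rw [h.pairType_addPoint (hs i) (hs j), h₁.pairType_addPoint (ht i) (ht j), hij]
  | k + 1, m, s, t, ε, hs, ht, e => by
    have step : ∀ X ∈ 𝓕, ∀ Y ∈ 𝓕₁, ∀ η : Prop,
        rankType r 𝓕 k (m + 1) (Fin.snoc s X) = rankType r₁ 𝓕₁ k (m + 1) (Fin.snoc t Y) →
        rankType r' 𝓖 k (m + 1)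
            (Fin.snoc (fun i => addPoint f p (s i) (ε i)) (addPoint f p X η)) =
          rankType r₁' 𝓖₁ k (m + 1)
            (Fin.snoc (fun i => addPoint f₁ p₁ (t i) (ε i)) (addPoint f₁ p₁ Y η)) := by
      intro X hX Y hY η e'
      have := rankType_addPoint_eq h h₁ (Fin.snoc ε η : Fin (m + 1) → Prop)
        (Fin.lastCases (by simpa using hX) (by simpa using hs))
        (Fin.lastCases (by simpa using hY) (by simpa using ht)) e'
      convert this using 2
      · funext i
        refine Fin.lastCases ?_ (fun i => ?_) i <;> simp
      · funext i
        refine Fin.lastCases ?_ (fun i => ?_) i <;> simp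
    refine rankType_succ_eq ?_ ?_
    · intro X' hX'
      obtain ⟨X, hX, η, rfl⟩ := h.exists_eq X' hX'
      obtain ⟨Y, hY, e'⟩ := exists_rankType_snoc_eq e hX
      exact ⟨_, h₁.add_mem Y hY η, step X hX Y hY η e'⟩
    · intro Y' hY'
      obtain ⟨Y, hY, η, rfl⟩ := h₁.exists_eq Y' hY'
      obtain ⟨X, hX, e'⟩ := exists_rankType_snoc_eq e.symm hY
      exact ⟨_, h.add_mem X hX η, step X hX Y hY η e'.symm⟩

theorem rankType_extension_eq {r₁ : γ → γ → Prop} {r₁' : δ → δ → Prop}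
    {𝓕 : Set (Set α)} {𝓖 : Set (Set β)} {f : α → β} {p : β}
    {𝓕₁ : Set (Set γ)} {𝓖₁ : Set (Set δ)} {f₁ : γ → δ} {p₁ : δ}
    (h : IsExtension r 𝓕 r' 𝓖 f p) (h₁ : IsExtension r₁ 𝓕₁ r₁' 𝓖₁ f₁ p₁) {k : ℕ}
    (e : rankType r 𝓕 k 0 Fin.elim0 = rankType r₁ 𝓕₁ k 0 Fin.elim0) :
    rankType r' 𝓖 k 0 Fin.elim0 = rankType r₁' 𝓖₁ k 0 Fin.elim0 := by
  convert rankType_addPoint_eq h h₁ Fin.elim0 (fun i => i.elim0) (fun i => i.elim0) e using 2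

theorem isExtension_fin (n : ℕ) :
    IsExtension (· < ·) (Set.univ : Set (Set (Fin n))) (· < ·) (Set.univ : Set (Set (Fin (n + 1))))
      Fin.castSucc (Fin.last n) where
  inj := Fin.castSucc_injective n
  rel_iff _ _ := Fin.castSucc_lt_castSucc_iff
  irrefl := lt_irrefl _
  lt_top _ _ a _ := Fin.castSucc_lt_last a
  not_top_lt _ _ a _ := (Fin.castSucc_lt_last a).not_gt
  add_mem _ _ _ := Set.mem_univ _
  exists_eq Y _ := by
    refine ⟨Fin.castSucc ⁻¹' Y, Set.mem_univ _, Fin.last n ∈ Y, ?_⟩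
    ext y
    refine Fin.lastCases ?_ (fun i => ?_) y
    · simp [addPoint, Fin.castSucc_ne_last]
    · simp [addPoint, Fin.castSucc_ne_last]

end RankTypes

/-! ### Semantics of the basic formulas -/

section Realize

variable {M : Type*} [Lmso.Structure M] {n : ℕ} {v : Empty → M} {xs : Fin n → M}

theorem realize_tv (i : Fin n) : (tv i).realize (Sum.elim v xs) = xs i := rfl

theorem realize_tb : (tb : Lmso.Term (Empty ⊕ Fin n)).realize (Sum.elim v xs) = botE M :=
  congrArg (Structure.funMap botC) (Subsingleton.elim _ _)

theorem realize_sub' (i j : Fin n) : (sub' i j).Realize v xs ↔ subE (xs i) (xs j) :=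
  BoundedFormula.realize_rel₂

theorem realize_exle' (i j : Fin n) : (exle' i j).Realize v xs ↔ exleE (xs i) (xs j) :=
  BoundedFormula.realize_rel₂

theorem realize_at' (i : Fin n) : (at' i).Realize v xs ↔ atE (xs i) :=
  BoundedFormula.realize_rel₁

theorem realize_eq' (i j : Fin n) : (eq' i j).Realize v xs ↔ xs i = xs j :=
  BoundedFormula.realize_bdEqual _ _

theorem realize_isBot' (i : Fin n) : (isBot' i).Realize v xs ↔ xs i = botE M := by
  rw [isBot', BoundedFormula.realize_bdEqual, realize_tv, realize_tb]

theorem realize_botSub' (i : Fin n) : (botSub' i).Realize v xs ↔ subE (botE M) (xs i) := by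
  rw [botSub', BoundedFormula.realize_rel₂, realize_tv, realize_tb]
  rfl

end Realize

/-! ### Definable predicates -/

/-- A predicate on `m`-tuples is definable by a formula without parameters. -/
def IsDefinable {M : Type*} [Lmso.Structure M] (m : ℕ) (P : (Fin m → M) → Prop) : Prop :=
  ∃ φ : BF m, ∀ xs, φ.Realize default xs ↔ P xs

namespace IsDefinable

variable {M : Type*} [Lmso.Structure M] {m : ℕ} {P Q : (Fin m → M) → Prop}

theorem congr (hP : IsDefinable m P) (h : ∀ xs, P xs ↔ Q xs) : IsDefinable m Q :=
  hP.imp fun _ hφ xs => (hφ xs).trans (h xs)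

theorem imp (hP : IsDefinable m P) (hQ : IsDefinable m Q) :
    IsDefinable m fun xs => P xs → Q xs := by
  obtain ⟨φ, hφ⟩ := hP
  obtain ⟨ψ, hψ⟩ := hQ
  exact ⟨φ.imp ψ, fun xs => by rw [BoundedFormula.realize_imp, hφ, hψ]⟩

theorem const (p : Prop) : IsDefinable m fun _ : Fin m → M => p := by
  by_cases hp : p
  · exact ⟨⊤, fun xs => by simp [hp]⟩
  · exact ⟨⊥, fun xs => by simp [hp]⟩

theorem not (hP : IsDefinable m P) : IsDefinable m fun xs => ¬P xs :=
  hP.imp (const False)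

theorem and (hP : IsDefinable m P) (hQ : IsDefinable m Q) :
    IsDefinable m fun xs => P xs ∧ Q xs :=
  (hP.imp hQ.not).not.congr fun xs => by tauto

theorem or (hP : IsDefinable m P) (hQ : IsDefinable m Q) :
    IsDefinable m fun xs => P xs ∨ Q xs :=
  (hP.not.imp hQ).congr fun xs => by tauto

theorem iff (hP : IsDefinable m P) (hQ : IsDefinable m Q) :
    IsDefinable m fun xs => (P xs ↔ Q xs) :=
  ((hP.imp hQ).and (hQ.imp hP)).congr fun xs => by tauto

theorem ex {R : (Fin m → M) → M → Prop}
    (hR : IsDefinable (m + 1) fun ys => R (fun i => ys i.castSucc) (ys (Fin.last m))) :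
    IsDefinable m fun xs => ∃ b, R xs b := by
  obtain ⟨φ, hφ⟩ := hR
  exact ⟨∃' φ, fun xs => by simp [BoundedFormula.realize_ex, hφ]⟩

theorem forall_finite {ι : Type*} [Finite ι] {R : ι → (Fin m → M) → Prop}
    (hR : ∀ i, IsDefinable m (R i)) : IsDefinable m fun xs => ∀ i, R i xs := by
  choose φ hφ using hR
  exact ⟨BoundedFormula.iInf φ, fun xs => by simp [hφ]⟩

theorem exists_finite {ι : Type*} [Finite ι] {R : ι → (Fin m → M) → Prop}
    (hR : ∀ i, IsDefinable m (R i)) : IsDefinable m fun xs => ∃ i, R i xs :=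
  (forall_finite fun i => (hR i).not).not.congr fun xs => by simp

theorem sub (i j : Fin m) : IsDefinable m fun xs : Fin m → M => subE (xs i) (xs j) :=
  ⟨sub' i j, fun _ => realize_sub' i j⟩

theorem exle (i j : Fin m) : IsDefinable m fun xs : Fin m → M => exleE (xs i) (xs j) :=
  ⟨exle' i j, fun _ => realize_exle' i j⟩

theorem atom (i : Fin m) : IsDefinable m fun xs : Fin m → M => atE (xs i) :=
  ⟨at' i, fun _ => realize_at' i⟩

theorem eq (i j : Fin m) : IsDefinable m fun xs : Fin m → M => xs i = xs j :=
  ⟨eq' i j, fun _ => realize_eq' i j⟩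

theorem isBot (i : Fin m) : IsDefinable m fun xs : Fin m → M => xs i = botE M :=
  ⟨isBot' i, fun _ => realize_isBot' i⟩

end IsDefinable

/-! ### Representations by sets -/

theorem snoc_apply {L γ : Type*} (f : L → γ) {m : ℕ} (a : Fin m → L) (c : L) :
    (Fin.snoc (fun i => f (a i)) (f c) : Fin (m + 1) → γ) =
      fun i => f ((Fin.snoc a c : Fin (m + 1) → L) i) :=
  (Fin.comp_snoc f a c).symm

/-- A representation of an `L_⊗`-structure by subsets of a set carrying a binary relation. -/
structure IsSetRep {M α : Type*} [Lmso.Structure M] (r : α → α → Prop) (ι : M → Set α) :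
    Prop where
  inj : Function.Injective ι
  bot_iff : ∀ a, a = botE M ↔ ι a = ∅
  at_iff : ∀ a, atE a ↔ ∃ x, ι a = {x}
  sub_iff : ∀ a b, subE a b ↔ ι a ⊆ ι b
  exle_iff : ∀ a b, exleE a b ↔ ∃ x ∈ ι a, ∃ y ∈ ι b, r x y

theorem isSetRep_id (α : Type*) [LinearOrder α] :
    IsSetRep (M := Set α) (· < ·) (id : Set α → Set α) where
  inj := Function.injective_id
  bot_iff _ := Iff.rfl
  at_iff _ := Iff.rfl
  sub_iff _ _ := Iff.rfl
  exle_iff _ _ := Iff.rfl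

namespace IsSetRep

variable {M α N β : Type*} [Lmso.Structure M] [Lmso.Structure N] {r : α → α → Prop}
  {ι : M → Set α} {r' : β → β → Prop} {κ : N → Set β}

theorem pairType_eq (hι : IsSetRep r ι) (a b : M) :
    pairType r (ι a) (ι b) = (a = botE M, atE a, subE a b, exleE a b) := by
  simp only [pairType, hι.bot_iff, hι.at_iff, hι.sub_iff, hι.exle_iff]

theorem eq_iff_sub (hι : IsSetRep r ι) (a b : M) : a = b ↔ subE a b ∧ subE b a := by
  rw [hι.sub_iff, hι.sub_iff, ← Set.Subset.antisymm_iff, hι.inj.eq_iff]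

/-- Equality of rank `k` types implies agreement on unnested formulas of quantifier rank at
most `k`. -/
theorem realize_iff (hι : IsSetRep r ι) (hκ : IsSetRep r' κ) :
    ∀ {m : ℕ} (φ : BF m) {k : ℕ} {v : Empty → M} {w : Empty → N} {a : Fin m → M} {b : Fin m → N},
      IsUnnested φ → qr φ ≤ k →
      rankType r (Set.range ι) k m (fun i => ι (a i)) =
        rankType r' (Set.range κ) k m (fun i => κ (b i)) →
      (φ.Realize v a ↔ φ.Realize w b) := by
  have key : ∀ {k m : ℕ} {a : Fin m → M} {b : Fin m → N},
      rankType r (Set.range ι) k m (fun i => ι (a i)) =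
        rankType r' (Set.range κ) k m (fun i => κ (b i)) → ∀ i j,
      (a i = botE M ↔ b i = botE N) ∧ (atE (a i) ↔ atE (b i)) ∧
        (subE (a i) (a j) ↔ subE (b i) (b j)) ∧ (exleE (a i) (a j) ↔ exleE (b i) (b j)) := by
    intro k m a b h i j
    have := pairType_eq_of_rankType_eq (Set.range_nonempty_iff_nonempty.2 ⟨botE M⟩) h i j
    rw [hι.pairType_eq, hκ.pairType_eq] at this
    simpa only [Prod.mk.injEq, eq_iff_iff] using this
  intro m φ
  induction φ with
  | falsum => intros; rfl
  | equal s t =>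
    rintro k v w a b (⟨i | i, j | j, rfl, rfl⟩ | ⟨c, j | j, rfl, rfl⟩) - h
    · exact i.elim
    · exact i.elim
    · exact j.elim
    · change a i = a j ↔ b i = b j
      rw [hι.eq_iff_sub, hκ.eq_iff_sub, (key h i j).2.2.1, (key h j i).2.2.1]
    · exact j.elim
    · have hM : (Constants.term c : Lmso.Term (Empty ⊕ Fin _)).realize (Sum.elim v a) = botE M :=
        realize_tb
      have hN : (Constants.term c : Lmso.Term (Empty ⊕ Fin _)).realize (Sum.elim w b) = botE N :=
        realize_tb
      change _ = a j ↔ _ = b j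
      rw [hM, hN, eq_comm, (key h j j).1, eq_comm]
  | @rel m l R ts =>
    intro k v w a b hts _ h
    have hts' : ∀ i, ∃ j : Fin m, ts i = tv j := by
      intro i
      obtain ⟨j | j, hj⟩ := hts i
      · exact j.elim
      · exact ⟨j, hj⟩
    choose g hg using hts'
    obtain rfl : ts = fun i => tv (g i) := funext hg
    match l, R with
    | 0, R => exact R.elim
    | 1, R =>
      have hl : (BoundedFormula.rel R fun i => tv (g i) : BF m) = at' (g 0) :=
        congrArg (BoundedFormula.rel R) (funext fun i => by fin_cases i; rfl)
      rw [hl, realize_at', realize_at']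
      exact (key h (g 0) (g 0)).2.1
    | 2, true =>
      have hl : (BoundedFormula.rel subR fun i => tv (g i) : BF m) = sub' (g 0) (g 1) :=
        congrArg (BoundedFormula.rel subR) (funext fun i => by fin_cases i <;> rfl)
      refine (iff_of_eq (congrArg (fun ψ : BF m => ψ.Realize v a) hl)).trans
        (Iff.trans ?_ (iff_of_eq (congrArg (fun ψ : BF m => ψ.Realize w b) hl)).symm)
      rw [realize_sub', realize_sub']
      exact (key h (g 0) (g 1)).2.2.1
    | 2, false =>
      have hl : (BoundedFormula.rel exleR fun i => tv (g i) : BF m) = exle' (g 0) (g 1) :=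
        congrArg (BoundedFormula.rel exleR) (funext fun i => by fin_cases i <;> rfl)
      refine (iff_of_eq (congrArg (fun ψ : BF m => ψ.Realize v a) hl)).trans
        (Iff.trans ?_ (iff_of_eq (congrArg (fun ψ : BF m => ψ.Realize w b) hl)).symm)
      rw [realize_exle', realize_exle']
      exact (key h (g 0) (g 1)).2.2.2
    | (l + 3), R => exact R.elim
  | imp φ ψ ihφ ihψ =>
    intro k v w a b hu hk h
    rw [BoundedFormula.realize_imp, BoundedFormula.realize_imp,
      ihφ hu.1 (le_trans (le_max_left _ _) hk) h, ihψ hu.2 (le_trans (le_max_right _ _) hk) h]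
  | all φ ih =>
    intro k v w a b hu hk h
    obtain ⟨k, rfl⟩ : ∃ k', k = k' + 1 := Nat.exists_eq_succ_of_ne_zero (by
      rintro rfl
      exact Nat.not_succ_le_zero _ hk)
    have hk' : qr φ ≤ k := Nat.le_of_succ_le_succ hk
    rw [BoundedFormula.realize_all, BoundedFormula.realize_all]
    constructor
    · intro hM d
      obtain ⟨_, ⟨c, rfl⟩, e⟩ := exists_rankType_snoc_eq h.symm ⟨d, rfl⟩
      rw [snoc_apply, snoc_apply] at e
      exact (ih hu hk' e.symm).1 (hM c)
    · intro hN c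
      obtain ⟨_, ⟨d, rfl⟩, e⟩ := exists_rankType_snoc_eq h ⟨c, rfl⟩
      rw [snoc_apply, snoc_apply] at e
      exact (ih hu hk' e).2 (hN d)

theorem equivK (hι : IsSetRep r ι) (hκ : IsSetRep r' κ) {k : ℕ}
    (h : rankType r (Set.range ι) k 0 Fin.elim0 = rankType r' (Set.range κ) k 0 Fin.elim0) :
    EquivK k M N := by
  intro φ hu hk
  refine hι.realize_iff hκ φ hu hk ?_
  convert h using 2

/-- The rank `k` type over the family of sets represented by elements below the point `x` is
definable. -/
theorem isDefinable_rankType (hι : IsSetRep r ι) :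
    ∀ {k m : ℕ} (t : RankType k m), IsDefinable (m + 1) fun xs : Fin (m + 1) → M =>
      rankType r (ι '' {a | ¬exleE (xs 0) a}) k m (fun i => ι (xs i.succ)) = t
  | 0, m, t => by
    have : IsDefinable (m + 1) fun xs : Fin (m + 1) → M => ∀ i j : Fin m,
        (xs i.succ = botE M ↔ (t i j).1) ∧ (atE (xs i.succ) ↔ (t i j).2.1) ∧
        (subE (xs i.succ) (xs j.succ) ↔ (t i j).2.2.1) ∧
        (exleE (xs i.succ) (xs j.succ) ↔ (t i j).2.2.2) :=
      .forall_finite fun i => .forall_finite fun j =>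
        ((IsDefinable.isBot _).iff (.const _)).and <| ((IsDefinable.atom _).iff (.const _)).and <|
        ((IsDefinable.sub _ _).iff (.const _)).and ((IsDefinable.exle _ _).iff (.const _))
    refine this.congr fun xs => ?_
    have h : rankType r (ι '' {a | ¬exleE (xs 0) a}) 0 m (fun i => ι (xs i.succ)) = t ↔
        ∀ i j, pairType r (ι (xs i.succ)) (ι (xs j.succ)) = t i j :=
      funext_iff.trans (forall_congr' fun i => funext_iff)
    rw [h]
    simp only [hι.pairType_eq, Prod.ext_iff, eq_iff_iff]
  | k + 1, m, t => by
    let t' : Set (RankType k (m + 1)) := t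
    have : IsDefinable (m + 1) fun xs : Fin (m + 1) → M => ∀ u : RankType k (m + 1),
        ((∃ b, ¬exleE (xs 0) b ∧ rankType r (ι '' {a | ¬exleE (xs 0) a}) k (m + 1)
          (Fin.snoc (fun i => ι (xs i.succ)) (ι b)) = u) ↔ u ∈ t') := by
      refine .forall_finite fun u => .iff (.ex ?_) (.const _)
      refine .and (IsDefinable.exle _ _).not ?_
      refine (hι.isDefinable_rankType u).congr fun ys => ?_
      have : (fun i : Fin (m + 1) => ι (ys i.succ)) =
          Fin.snoc (fun i : Fin m => ι (ys i.succ.castSucc)) (ι (ys (Fin.last (m + 1)))) := by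
        funext i
        refine Fin.lastCases ?_ (fun i => ?_) i <;> simp
      rw [this]
      rfl
    refine this.congr fun xs => ?_
    refine Iff.trans ?_ (Set.ext_iff (α := RankType k (m + 1))).symm
    refine forall_congr' fun u => iff_congr ?_ Iff.rfl
    change _ ↔ ∃ X ∈ ι '' _, _
    simp

end IsSetRep

/-! ### Consequences of the axioms -/

section Axioms

variable {M : Type*} [Lmso.Structure M]

theorem subE_antisymm (hM : M ⊨ TMSOFin) {a b : M} (hab : subE a b) (hba : subE b a) : a = b := by
  have h : M ⊨ axAntisymm := hM.realize_of_mem _ (by simp [TMSOFin, Tbase])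
  simp [axAntisymm, Sentence.Realize, Formula.Realize, realize_sub', realize_eq', Fin.snoc] at h
  exact h a b hab hba

theorem subE_refl (hM : M ⊨ TMSOFin) (a : M) : subE a a := by
  have h : M ⊨ axRefl := hM.realize_of_mem _ (by simp [TMSOFin, Tbase])
  simp [axRefl, Sentence.Realize, Formula.Realize, realize_sub', Fin.snoc] at h
  exact h a

theorem subE_trans (hM : M ⊨ TMSOFin) {a b c : M} (hab : subE a b) (hbc : subE b c) :
    subE a c := by
  have h : M ⊨ axTrans := hM.realize_of_mem _ (by simp [TMSOFin, Tbase])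
  simp [axTrans, Sentence.Realize, Formula.Realize, realize_sub', Fin.snoc] at h
  exact h a b c hab hbc

theorem botE_subE (hM : M ⊨ TMSOFin) (a : M) : subE (botE M) a := by
  have h : M ⊨ axBotLe := hM.realize_of_mem _ (by simp [TMSOFin, Tbase])
  simp [axBotLe, Sentence.Realize, Formula.Realize, realize_botSub', Fin.snoc] at h
  exact h a

theorem exists_meet (hM : M ⊨ TMSOFin) (a b : M) :
    ∃ c, (subE c a ∧ subE c b) ∧ ∀ d, subE d a → subE d b → subE d c := by
  have h : M ⊨ axMeet := hM.realize_of_mem _ (by simp [TMSOFin, Tbase])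
  simp [axMeet, isMeet, Sentence.Realize, Formula.Realize, realize_sub', Fin.snoc] at h
  exact h a b

theorem exists_join (hM : M ⊨ TMSOFin) (a b : M) :
    ∃ c, (subE a c ∧ subE b c) ∧ ∀ d, subE a d → subE b d → subE c d := by
  have h : M ⊨ axJoin := hM.realize_of_mem _ (by simp [TMSOFin, Tbase])
  simp [axJoin, isJoin, Sentence.Realize, Formula.Realize, realize_sub', Fin.snoc] at h
  exact h a b

theorem exists_compl (hM : M ⊨ TMSOFin) (a : M) :
    ∃ b, (∀ c, subE c a → subE c b → c = botE M) ∧ ∀ c, subE a c → subE b c → ∀ d, subE d c := by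
  have h : M ⊨ axCompl := hM.realize_of_mem _ (by simp [TMSOFin, Tbase])
  simp [axCompl, isComplOf, meetIsBot, joinIsTop, Sentence.Realize, Formula.Realize, realize_sub',
    realize_isBot', Fin.snoc] at h
  exact h a

theorem subE_distrib (hM : M ⊨ TMSOFin) {a b c ab ac bc l u : M}
    (hab : (subE ab a ∧ subE ab b) ∧ ∀ d, subE d a → subE d b → subE d ab)
    (hac : (subE ac a ∧ subE ac c) ∧ ∀ d, subE d a → subE d c → subE d ac)
    (hbc : (subE b bc ∧ subE c bc) ∧ ∀ d, subE b d → subE c d → subE bc d)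
    (hl : (subE l a ∧ subE l bc) ∧ ∀ d, subE d a → subE d bc → subE d l)
    (hu : (subE ab u ∧ subE ac u) ∧ ∀ d, subE ab d → subE ac d → subE u d) : subE l u := by
  have h : M ⊨ axDistrib := hM.realize_of_mem _ (by simp [TMSOFin, Tbase])
  simp [axDistrib, isMeet, isJoin, Sentence.Realize, Formula.Realize, realize_sub',
    Fin.snoc] at h
  exact h a b c ab ac bc l u hab.1.1 hab.1.2 hab.2 hac.1.1 hac.1.2 hac.2 hbc.1.1 hbc.1.2 hbc.2
    hl.1.1 hl.1.2 hl.2 hu.1.1 hu.1.2 hu.2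

theorem atE_iff (hM : M ⊨ TMSOFin) (a : M) :
    atE a ↔ a ≠ botE M ∧ ∀ b, subE b a → b = botE M ∨ b = a := by
  have h : M ⊨ axAt := hM.realize_of_mem _ (by simp [TMSOFin, Tbase])
  simp [axAt, isAtomDef, Sentence.Realize, Formula.Realize, realize_sub', realize_isBot',
    realize_at', realize_eq', Fin.snoc] at h
  exact h a

theorem exists_atE_subE (hM : M ⊨ TMSOFin) {a : M} (ha : a ≠ botE M) : ∃ x, atE x ∧ subE x a := by
  have h : M ⊨ axAtomic := hM.realize_of_mem _ (by simp [TMSOFin, Tbase])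
  simp [axAtomic, Sentence.Realize, Formula.Realize, realize_sub', realize_isBot',
    realize_at', Fin.snoc] at h
  exact h a ha

theorem not_exleE_self (hM : M ⊨ TMSOFin) {x : M} (hx : atE x) : ¬exleE x x := by
  have h : M ⊨ axIrrefl := hM.realize_of_mem _ (by simp [TMSOFin, Tbase])
  simp [axIrrefl, Sentence.Realize, Formula.Realize, realize_exle', realize_at', Fin.snoc] at h
  exact h x hx

theorem exleE_trans (hM : M ⊨ TMSOFin) {x y z : M} (hx : atE x) (hy : atE y) (hz : atE z)
    (hxy : exleE x y) (hyz : exleE y z) : exleE x z := by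
  have h : M ⊨ axTransAt := hM.realize_of_mem _ (by simp [TMSOFin, Tbase])
  simp [axTransAt, Sentence.Realize, Formula.Realize, realize_exle', realize_at', Fin.snoc] at h
  exact h x y z hx hy hz hxy hyz

theorem exleE_trichotomy (hM : M ⊨ TMSOFin) {x y : M} (hx : atE x) (hy : atE y) :
    (exleE x y ∨ x = y) ∨ exleE y x := by
  have h : M ⊨ axTrich := hM.realize_of_mem _ (by simp [TMSOFin, Tbase])
  simp [axTrich, Sentence.Realize, Formula.Realize, realize_exle', realize_at', realize_eq',
    Fin.snoc] at h
  exact h x y hx hy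

theorem exleE_iff (hM : M ⊨ TMSOFin) (a b : M) :
    exleE a b ↔ ∃ x y, ((((atE x ∧ atE y) ∧ subE x a) ∧ subE y b) ∧ exleE x y) := by
  have h : M ⊨ axExleDef := hM.realize_of_mem _ (by simp [TMSOFin, Tbase])
  simp [axExleDef, Sentence.Realize, Formula.Realize, realize_exle', realize_at', realize_sub',
    Fin.snoc] at h
  simpa using h a b

theorem exists_greatest_atom (hM : M ⊨ TMSOFin) {x : M} (hx : atE x) :
    ∃ g : M, atE g ∧ ∀ y, atE y → ¬exleE g y := by
  have h : M ⊨ axGreatestAtom := hM.realize_of_mem _ (by simp [TMSOFin, Tbase])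
  simp [axGreatestAtom, isGreatestAtom, Sentence.Realize, Formula.Realize, realize_exle',
    realize_at', Fin.snoc] at h
  exact h x hx

theorem exists_pred_atom (hM : M ⊨ TMSOFin) {x y : M} (hx : atE x) (hy : atE y)
    (hyx : exleE y x) :
    ∃ z : M, ((atE z ∧ atE x) ∧ exleE z x) ∧ ∀ w, atE w → exleE z w → w = x ∨ exleE x w := by
  have h : M ⊨ axPred := hM.realize_of_mem _ (by simp [TMSOFin, Tbase])
  simp [axPred, isSuccOf, Sentence.Realize, Formula.Realize, realize_exle',
    realize_at', realize_eq', Fin.snoc] at h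
  simpa using h x hx y hy hyx

theorem exists_least_atom_subE (hM : M ⊨ TMSOFin) {a : M} (ha : a ≠ botE M) :
    ∃ x : M, (atE x ∧ subE x a) ∧ ∀ y, atE y → subE y a → ¬exleE y x := by
  have h : M ⊨ axLeastIn := hM.realize_of_mem _ (by simp [TMSOFin, Tbase])
  simp [axLeastIn, Sentence.Realize, Formula.Realize, realize_exle', realize_sub', realize_isBot',
    realize_at', Fin.snoc] at h
  simpa using h a ha

theorem exists_comprehension (hM : M ⊨ TMSOFin) {n : ℕ} {P : (Fin (n + 1) → M) → Prop}
    (hP : IsDefinable (n + 1) P) (ys : Fin n → M) :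
    ∃ X, ∀ x, atE x → (subE x X ↔ P (Fin.snoc ys x)) := by
  obtain ⟨η, hη⟩ := hP
  have h : M ⊨ compAx η := hM.realize_of_mem _ (Or.inl (Or.inr (Set.mem_iUnion.2 ⟨n, η, rfl⟩)))
  rw [compAx, Sentence.Realize, BoundedFormula.realize_alls] at h
  simp only [BoundedFormula.realize_ex, BoundedFormula.realize_all, BoundedFormula.realize_imp,
    BoundedFormula.realize_iff, realize_at', realize_sub',
    BoundedFormula.realize_liftAt_one (Nat.le_succ n), Fin.snoc_last, Fin.snoc_castSucc] at h
  obtain ⟨X, hX⟩ := h ys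
  refine ⟨X, fun x hx => (hX x hx).trans ?_⟩
  rw [← hη]
  refine iff_of_eq (congrArg (η.Realize default) (funext fun i => ?_))
  refine Fin.lastCases ?_ (fun i => ?_) i
  · simp
  · simp

end Axioms

/-! ### Models as algebras of sets of atoms -/

section Atoms

variable {M : Type*} [Lmso.Structure M]

/-- The set of atoms contained in an element. -/
def atomsBelow (a : M) : Set M := {x | atE x ∧ subE x a}

theorem eq_of_atE_of_subE (hM : M ⊨ TMSOFin) {x y : M} (hx : atE x) (hy : atE y)
    (h : subE x y) : x = y :=
  (((atE_iff hM y).1 hy).2 x h).resolve_left ((atE_iff hM x).1 hx).1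

theorem subE_of_atomsBelow_subset (hM : M ⊨ TMSOFin) {a b : M}
    (h : atomsBelow a ⊆ atomsBelow b) : subE a b := by
  obtain ⟨b', hb', htop⟩ := exists_compl hM b
  obtain ⟨ab, hab⟩ := exists_meet hM a b
  obtain ⟨ac, hac⟩ := exists_meet hM a b'
  obtain ⟨bc, hbc⟩ := exists_join hM b b'
  obtain ⟨l, hl⟩ := exists_meet hM a bc
  obtain ⟨u, hu⟩ := exists_join hM ab ac
  have hac_bot : ac = botE M := by
    by_contra hne
    obtain ⟨x, hx, hxac⟩ := exists_atE_subE hM hne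
    have hxb := (h ⟨hx, subE_trans hM hxac hac.1.1⟩).2
    exact ((atE_iff hM x).1 hx).1 (hb' x hxb (subE_trans hM hxac hac.1.2))
  have hal : subE a l := hl.2 a (subE_refl hM a) (htop bc hbc.1.1 hbc.1.2 a)
  have hub : subE u b := hu.2 b hab.1.2 (hac_bot ▸ botE_subE hM b)
  exact subE_trans hM hal (subE_trans hM (subE_distrib hM hab hac hbc hl hu) hub)

theorem atomsBelow_atom (hM : M ⊨ TMSOFin) {x : M} (hx : atE x) : atomsBelow x = {x} :=
  Set.eq_singleton_iff_unique_mem.2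
    ⟨⟨hx, subE_refl hM x⟩, fun _ hy => eq_of_atE_of_subE hM hy.1 hx hy.2⟩

theorem atomsBelow_injective (hM : M ⊨ TMSOFin) :
    Function.Injective (atomsBelow : M → Set M) := fun _ _ h =>
  subE_antisymm hM (subE_of_atomsBelow_subset hM h.subset)
    (subE_of_atomsBelow_subset hM h.superset)

theorem eq_botE_iff (hM : M ⊨ TMSOFin) (a : M) : a = botE M ↔ atomsBelow a = ∅ := by
  constructor
  · rintro rfl
    refine Set.eq_empty_iff_forall_notMem.2 fun x hx => ((atE_iff hM x).1 hx.1).1 ?_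
    exact subE_antisymm hM hx.2 (botE_subE hM x)
  · intro h
    by_contra hne
    obtain ⟨x, hx⟩ := exists_atE_subE hM hne
    exact Set.eq_empty_iff_forall_notMem.1 h x hx

theorem isSetRep_atomsBelow (hM : M ⊨ TMSOFin) : IsSetRep exleE (atomsBelow : M → Set M) where
  inj := atomsBelow_injective hM
  bot_iff := eq_botE_iff hM
  at_iff a := by
    refine ⟨fun ha => ⟨a, atomsBelow_atom hM ha⟩, ?_⟩
    rintro ⟨x, hx⟩
    have hxa : x ∈ atomsBelow a := hx ▸ rfl
    rw [← atomsBelow_atom hM hxa.1] at hx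
    exact atomsBelow_injective hM hx ▸ hxa.1
  sub_iff a b := ⟨fun h _ hx => ⟨hx.1, subE_trans hM hx.2 h⟩, subE_of_atomsBelow_subset hM⟩
  exle_iff a b := by
    rw [exleE_iff hM]
    constructor
    · rintro ⟨x, y, ⟨⟨⟨hx, hy⟩, hxa⟩, hyb⟩, hxy⟩
      exact ⟨x, ⟨hx, hxa⟩, y, ⟨hy, hyb⟩, hxy⟩
    · rintro ⟨x, ⟨hx, hxa⟩, y, ⟨hy, hyb⟩, hxy⟩
      exact ⟨x, y, ⟨⟨⟨hx, hy⟩, hxa⟩, hyb⟩, hxy⟩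

theorem exleE_atom_iff (hM : M ⊨ TMSOFin) {x : M} (hx : atE x) (a : M) :
    exleE x a ↔ ∃ y ∈ atomsBelow a, exleE x y := by
  rw [(isSetRep_atomsBelow hM).exle_iff, atomsBelow_atom hM hx]
  simp

theorem not_exleE_of_exleE (hM : M ⊨ TMSOFin) {x y : M} (hx : atE x) (hy : atE y)
    (hxy : exleE x y) : ¬exleE y x := fun hyx =>
  not_exleE_self hM hx (exleE_trans hM hx hy hx hxy hyx)

/-- The sets of atoms, represented in `M`, all of whose members are at most `x`. -/
def lowerSets (x : M) : Set (Set M) := atomsBelow '' {a | ¬exleE x a}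

/-- The sets of atoms, represented in `M`, all of whose members are strictly below `x`. -/
def strictLowerSets (x : M) : Set (Set M) := atomsBelow '' {a | ∀ y ∈ atomsBelow a, exleE y x}

theorem isExtension_lowerSets (hM : M ⊨ TMSOFin) {x : M} (hx : atE x) :
    IsExtension exleE (strictLowerSets x) exleE (lowerSets x) id x where
  inj := Function.injective_id
  rel_iff _ _ := Iff.rfl
  irrefl := not_exleE_self hM hx
  lt_top := by
    rintro _ ⟨a, ha, rfl⟩ y hy
    exact ha y hy
  not_top_lt := by
    rintro _ ⟨a, ha, rfl⟩ y hy
    exact not_exleE_of_exleE hM hy.1 hx (ha y hy)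
  add_mem := by
    rintro _ ⟨a, ha, rfl⟩ ε
    have hdef : IsDefinable 3 fun xs : Fin 3 → M => subE (xs 2) (xs 0) ∨ (xs 2 = xs 1 ∧ ε) :=
      (IsDefinable.sub 2 0).or ((IsDefinable.eq 2 1).and (.const ε))
    obtain ⟨c, hc⟩ := exists_comprehension hM hdef ![a, x]
    replace hc : ∀ y, atE y → (subE y c ↔ subE y a ∨ (y = x ∧ ε)) := hc
    refine ⟨c, ?_, ?_⟩
    · rw [Set.mem_ofPred_eq, exleE_atom_iff hM hx]
      rintro ⟨y, hy, hxy⟩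
      rcases (hc y hy.1).1 hy.2 with hya | ⟨rfl, -⟩
      · exact not_exleE_of_exleE hM hx hy.1 hxy (ha y ⟨hy.1, hya⟩)
      · exact not_exleE_self hM hx hxy
    · ext y
      simp only [addPoint, Set.image_id, Set.mem_union, atomsBelow, Set.mem_ofPred_eq]
      constructor
      · rintro ⟨hy, hyc⟩
        exact ((hc y hy).1 hyc).imp (fun h => ⟨hy, h⟩) id
      · rintro (⟨hy, hya⟩ | ⟨rfl, hε⟩)
        · exact ⟨hy, (hc y hy).2 (Or.inl hya)⟩
        · exact ⟨hx, (hc y hx).2 (Or.inr ⟨rfl, hε⟩)⟩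
  exists_eq := by
    rintro _ ⟨c, hc, rfl⟩
    have hdef : IsDefinable 3 fun xs : Fin 3 → M => subE (xs 2) (xs 0) ∧ ¬xs 2 = xs 1 :=
      (IsDefinable.sub 2 0).and (IsDefinable.eq 2 1).not
    obtain ⟨a, ha⟩ := exists_comprehension hM hdef ![c, x]
    replace ha : ∀ y, atE y → (subE y a ↔ subE y c ∧ ¬y = x) := ha
    rw [Set.mem_ofPred_eq, exleE_atom_iff hM hx] at hc
    refine ⟨_, ⟨a, ?_, rfl⟩, subE x c, ?_⟩
    · rintro y ⟨hy, hya⟩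
      obtain ⟨hyc, hne⟩ := (ha y hy).1 hya
      rcases exleE_trichotomy hM hx hy with (hxy | rfl) | hyx
      · exact absurd ⟨y, ⟨hy, hyc⟩, hxy⟩ hc
      · exact absurd rfl hne
      · exact hyx
    · ext y
      simp only [addPoint, Set.image_id, Set.mem_union, atomsBelow, Set.mem_ofPred_eq]
      constructor
      · rintro (⟨hy, hya⟩ | ⟨rfl, hxc⟩)
        · exact ⟨hy, ((ha y hy).1 hya).1⟩
        · exact ⟨hx, hxc⟩
      · rintro ⟨hy, hyc⟩
        by_cases hyx : y = x
        · exact Or.inr ⟨hyx, hyx ▸ hyc⟩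
        · exact Or.inl ⟨hy, (ha y hy).2 ⟨hyc, hyx⟩⟩

theorem strictLowerSets_of_least (hM : M ⊨ TMSOFin) {x : M}
    (hx : ∀ y, atE y → ¬exleE y x) : strictLowerSets x = {∅} := by
  refine Set.Subset.antisymm ?_ ?_
  · rintro _ ⟨a, ha, rfl⟩
    exact Set.eq_empty_iff_forall_notMem.2 fun y hy => hx y hy.1 (ha y hy)
  · rintro _ rfl
    have hbot := (eq_botE_iff hM (botE M)).1 rfl
    refine ⟨botE M, fun y hy => ?_, hbot⟩
    rw [hbot] at hy
    exact hy.elim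

theorem strictLowerSets_of_pred (hM : M ⊨ TMSOFin) {x z : M} (hx : atE x) (hz : atE z)
    (hzx : exleE z x) (h : ∀ w, atE w → exleE z w → w = x ∨ exleE x w) :
    strictLowerSets x = lowerSets z := by
  refine congrArg (Set.image atomsBelow) (Set.ext fun a => ?_)
  rw [Set.mem_ofPred_eq, Set.mem_ofPred_eq, exleE_atom_iff hM hz]
  constructor
  · rintro ha ⟨y, hy, hzy⟩
    have hyx := ha y hy
    rcases h y hy.1 hzy with rfl | hxy
    · exact not_exleE_self hM hx hyx
    · exact not_exleE_of_exleE hM hx hy.1 hxy hyx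
  · intro ha y hy
    rcases exleE_trichotomy hM hx hy.1 with (hxy | rfl) | hyx
    · exact absurd ⟨y, hy, exleE_trans hM hz hx hy.1 hzx hxy⟩ ha
    · exact absurd ⟨x, hy, hzx⟩ ha
    · exact hyx

theorem lowerSets_of_greatest (hM : M ⊨ TMSOFin) {g : M} (hg : atE g)
    (h : ∀ y, atE y → ¬exleE g y) : lowerSets g = Set.range atomsBelow := by
  have : {a : M | ¬exleE g a} = Set.univ := by
    refine Set.eq_univ_of_forall fun a => ?_
    rw [Set.mem_ofPred_eq, exleE_atom_iff hM hg]
    rintro ⟨y, hy, hgy⟩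
    exact h y hy.1 hgy
  rw [lowerSets, this, Set.image_univ]

theorem rankType_singleton_empty_eq_fin_zero (k : ℕ) :
    rankType (exleE : M → M → Prop) {∅} k 0 Fin.elim0 =
      rankType (· < ·) (Set.univ : Set (Set (Fin 0))) k 0 Fin.elim0 := by
  have huniv : (Set.univ : Set (Set (Fin 0))) = {∅} :=
    Set.eq_singleton_iff_unique_mem.2 ⟨Set.mem_univ _, fun _ _ => Subsingleton.elim _ _⟩
  rw [huniv]
  convert rankType_singleton_empty (exleE : M → M → Prop) ((· < ·) : Fin 0 → Fin 0 → Prop) k 0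
    using 2

/-- Every initial segment of the atoms has the same rank `k` type as a finite linear order. -/
theorem exists_rankType_lowerSets_eq (hM : M ⊨ TMSOFin) (k : ℕ) {x : M} (hx : atE x) :
    ∃ n : ℕ, rankType exleE (lowerSets x) k 0 Fin.elim0 =
      rankType (· < ·) (Set.univ : Set (Set (Fin n))) k 0 Fin.elim0 := by
  let P : M → Prop := fun x => ∃ n : ℕ, rankType exleE (lowerSets x) k 0 Fin.elim0 =
    rankType (· < ·) (Set.univ : Set (Set (Fin n))) k 0 Fin.elim0
  have hdef : IsDefinable 1 fun xs : Fin 1 → M => ¬P (xs 0) := by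
    have := IsDefinable.exists_finite fun t : {t : RankType k 0 // ∃ n : ℕ,
      t = rankType (· < ·) (Set.univ : Set (Set (Fin n))) k 0 Fin.elim0} =>
        (isSetRep_atomsBelow hM).isDefinable_rankType t.1
    refine (this.congr fun xs => ?_).not
    have hnil : (fun i : Fin 0 => atomsBelow (xs i.succ)) = Fin.elim0 := Subsingleton.elim _ _
    rw [hnil]
    exact ⟨fun ⟨⟨_, n, hn⟩, ht⟩ => ⟨n, ht.trans hn⟩, fun ⟨n, hn⟩ => ⟨⟨_, n, rfl⟩, hn⟩⟩
  obtain ⟨X, hX⟩ := exists_comprehension hM hdef ![]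
  replace hX : ∀ y, atE y → (subE y X ↔ ¬P y) := hX
  by_contra hPx
  have hne : X ≠ botE M := by
    rw [Ne, eq_botE_iff hM]
    exact Set.nonempty_iff_ne_empty.1 ⟨x, hx, (hX x hx).2 hPx⟩
  obtain ⟨y, ⟨hy, hyX⟩, hleast⟩ := exists_least_atom_subE hM hne
  refine (hX y hy).1 hyX ?_
  by_cases hmin : ∃ z : M, atE z ∧ exleE z y
  · obtain ⟨z', hz', hzy'⟩ := hmin
    obtain ⟨z, ⟨⟨hz, -⟩, hzy⟩, hsucc⟩ := exists_pred_atom hM hy hz' hzy'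
    have hPz : P z := by
      by_contra hPz
      exact hleast z hz ((hX z hz).2 hPz) hzy
    obtain ⟨n, hn⟩ := hPz
    rw [← strictLowerSets_of_pred hM hy hz hzy hsucc] at hn
    exact ⟨n + 1, rankType_extension_eq (isExtension_lowerSets hM hy) (isExtension_fin n) hn⟩
  · have h0 := rankType_singleton_empty_eq_fin_zero (M := M) k
    rw [← strictLowerSets_of_least hM fun z hz hzy => hmin ⟨z, hz, hzy⟩] at h0
    exact ⟨1, rankType_extension_eq (isExtension_lowerSets hM hy) (isExtension_fin 0) h0⟩

end Atoms

theorem statement6 (k : ℕ) (M : Type) [Lmso.Structure M] (hM : M ⊨ TMSOFin) :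
    ∃ n : ℕ, EquivK k M (MSOn n) := by
  suffices h : ∃ n : ℕ, rankType exleE (Set.range (atomsBelow : M → Set M)) k 0 Fin.elim0 =
      rankType (· < ·) (Set.univ : Set (Set (Fin n))) k 0 Fin.elim0 by
    obtain ⟨n, hn⟩ := h
    refine ⟨n, (isSetRep_atomsBelow hM).equivK (isSetRep_id (Fin n)) ?_⟩
    rwa [Set.range_id]
  by_cases hat : ∃ x : M, atE x
  · obtain ⟨x, hx⟩ := hat
    obtain ⟨g, hg, hgreatest⟩ := exists_greatest_atom hM hx
    rw [← lowerSets_of_greatest hM hg hgreatest]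
    exact exists_rankType_lowerSets_eq hM k hg
  · have hempty (a : M) : atomsBelow a = ∅ :=
      Set.eq_empty_iff_forall_notMem.2 fun x hx => hat ⟨x, hx.1⟩
    have hrange : Set.range (atomsBelow : M → Set M) = {∅} :=
      Set.Subset.antisymm (Set.range_subset_iff.2 hempty)
        (Set.singleton_subset_iff.2 ⟨botE M, hempty _⟩)
    rw [hrange]
    exact ⟨0, rankType_singleton_empty_eq_fin_zero k⟩

end MSO
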